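/- Let Y be a tail process with index α > 0 and finitely many exceedance-points (i.e. Y is a random element of ℝ₀^{ℤ^d} satisfying the tail-process identity, |Y_0| is Pareto(α)-distributed and independent of the spectral process Θ = Y/|Y_0|, and P(Θ ∈ l₀) = 1), set ϑ := E[1/|e(Y)|], and let Q = (Q_i)_{i∈ℤ^d} be any representative of the anchored spectral tail process. Then E[Σ_{k∈ℤ^d} |Q_k|^α] = ϑ^{−1} < ∞ and E[ ‖Θ‖^α / Σ_{k∈ℤ^d} |Θ_k|^α ] = ϑ > 0. -/

import Mathlib

open MeasureTheory ENNReal Filter ProbabilityTheory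

noncomputable section

/-- The space `ℝ^{ℤ^d}` of real-valued fields indexed by `ℤ^d`. -/
abbrev RField (d : ℕ) := (Fin d → ℤ) → ℝ

variable {d : ℕ}

/-- Shift operator: `shift k x = (x_{i+k})_i`, i.e. it moves the origin to `k`. -/
def shift (k : Fin d → ℤ) (x : RField d) : RField d := fun i => x (i + k)

/-- The set of exceedance-points of `x`. -/
def excSet (x : RField d) : Set (Fin d → ℤ) := {k | 1 < |x k|}

open Classical in
/-- Indicator (with values in `ℝ≥0∞`) of the event that `|x k| > s`. -/
def exIndGT (s : ℝ) (k : Fin d → ℤ) (x : RField d) : ℝ≥0∞ := if s < |x k| then 1 else 0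

/-- The tail-process identity:
`E[h(θ_k Y) 1{|Y_k| > 1}] = E[h(Y) 1{|Y_{−k}| > 1}]` for every measurable nonnegative `h`
and every `k ∈ ℤ^d`. -/
def TailIdentity {Ω : Type*} [MeasurableSpace Ω] (μ : Measure Ω) (Y : Ω → RField d) : Prop :=
  ∀ h : RField d → ℝ≥0∞, Measurable h → ∀ k : Fin d → ℤ,
    ∫⁻ ω, h (shift k (Y ω)) * exIndGT 1 k (Y ω) ∂μ
      = ∫⁻ ω, h (Y ω) * exIndGT 1 (-k) (Y ω) ∂μ

/-- `Y` is exceedance-stationary: for every exceedance-map `τ` which is bijective on a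
measurable set `B` (invariant under shifting the origin to exceedance-points, contained in
`ℝ₀^{ℤ^d}`) carrying the law of `Y`, we have `θ_τ Y ≐ Y`. -/
def ExcStationary {Ω : Type*} [MeasurableSpace Ω] (μ : Measure Ω) (Y : Ω → RField d) : Prop :=
  ∀ (B : Set (RField d)) (τ : RField d → Fin d → ℤ),
    MeasurableSet B → Measurable τ →
    (∀ x ∈ B, 1 < |x 0|) →
    (∀ x ∈ B, ∀ k ∈ excSet x, shift k x ∈ B) →
    (∀ x ∈ B, τ x ∈ excSet x) →
    (∀ x ∈ B, Set.BijOn (fun k => k + τ (shift k x)) (excSet x) (excSet x)) →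
    (∀ᵐ ω ∂μ, Y ω ∈ B) →
    Measure.map (fun ω => shift (τ (Y ω)) (Y ω)) μ = Measure.map Y μ

/-- `E₀`: elements of `ℝ₀^{ℤ^d}` with finitely many exceedance-points. -/
def E0set (d : ℕ) : Set (RField d) := {x | 1 < |x 0| ∧ (excSet x).Finite}

/-- `E`: elements of `ℝ^{ℤ^d}` with at least one but finitely many exceedance-points. -/
def Eset (d : ℕ) : Set (RField d) := {x | (excSet x).Nonempty ∧ (excSet x).Finite}

/-- `l₀`: fields vanishing at infinity. -/
def l0set (d : ℕ) : Set (RField d) := {x | Tendsto (fun i => |x i|) cofinite (nhds 0)}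

/-- Uniform norm `‖x‖ = sup_i |x_i|`. -/
def supNorm (x : RField d) : ℝ := ⨆ i, |x i|

/-- `V` is Pareto(α)-distributed: `P(V > y) = y^{-α}` for `y ≥ 1`. -/
def IsPareto {Ω : Type*} [MeasurableSpace Ω] (μ : Measure Ω) (V : Ω → ℝ) (α : ℝ) : Prop :=
  ∀ y : ℝ, 1 ≤ y → μ {ω | y < V ω} = ENNReal.ofReal (y ^ (-α))

/-- An anchoring function on `S`: a measurable shift-covariant exceedance-map. -/
def IsAnchoringOn (S : Set (RField d)) (A : RField d → Fin d → ℤ) : Prop :=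
  Measurable A ∧ ∀ x ∈ S, A x ∈ excSet x ∧ ∀ k ∈ excSet x, A (shift k x) + k = A x

/-- `h` is shift-invariant on `S`. -/
def ShiftInvariantOn (S : Set (RField d)) (h : RField d → ℝ≥0∞) : Prop :=
  ∀ x ∈ S, ∀ k : Fin d → ℤ, h (shift k x) = h x

/-- Data of a first-maximum anchoring function `A^{fm}`: a translation-invariant linear
(group) order `r` on `ℤ^d`, and a measurable map `Afm` which picks, for every nonzero
`x ∈ l₀`, the `r`-smallest index at which `|x|` attains its maximum `‖x‖`. -/
structure FirstMaxData (d : ℕ) where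
  r : (Fin d → ℤ) → (Fin d → ℤ) → Prop
  Afm : RField d → Fin d → ℤ
  r_linear : IsLinearOrder (Fin d → ℤ) r
  r_add_invariant : ∀ a b c : Fin d → ℤ, r a b → r (a + c) (b + c)
  meas : Measurable Afm
  mem_argmax : ∀ x ∈ l0set d, x ≠ 0 → |x (Afm x)| = supNorm x
  min_argmax : ∀ x ∈ l0set d, x ≠ 0 → ∀ k : Fin d → ℤ, |x k| = supNorm x → r (Afm x) k

/-- `Q` (a random element of `l₀` on `(Ω₂, μ₂)`) is a representative of the anchored spectral
tail process of `Θ`: `E[h(Q)] = E[h(Θ) | A^{fm}(Θ) = 0]` for every shift-invariant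
measurable `h : l₀ → [0,∞)`. -/
def IsSpectralRep {Ω : Type*} [MeasurableSpace Ω] (μ : Measure Ω) (Θ : Ω → RField d)
    (F : FirstMaxData d) {Ω₂ : Type*} [MeasurableSpace Ω₂] (μ₂ : Measure Ω₂)
    (Q : Ω₂ → RField d) : Prop :=
  ∀ h : RField d → ℝ≥0∞, Measurable h → ShiftInvariantOn (l0set d) h →
    ∫⁻ ω, h (Q ω) ∂μ₂
      = ∫⁻ x, h x ∂(ProbabilityTheory.cond (Measure.map Θ μ) {x | F.Afm x = 0})

lemma measurable_shift (k : Fin d → ℤ) : Measurable (shift k : RField d → RField d) :=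
  measurable_pi_lambda _ fun i => measurable_pi_apply (i + k)

lemma measurable_abs_apply (k : Fin d → ℤ) : Measurable fun x : RField d => |x k| :=
  continuous_abs.measurable.comp (measurable_pi_apply k)

lemma measurable_exIndGT (s : ℝ) (k : Fin d → ℤ) :
    Measurable (exIndGT s k : RField d → ℝ≥0∞) := by
  unfold exIndGT
  exact Measurable.ite (measurableSet_lt measurable_const (measurable_abs_apply k))
    measurable_const measurable_const

lemma measurable_supNorm : Measurable (supNorm : RField d → ℝ) :=
  Measurable.iSup measurable_abs_apply

/-- The `α`-power sum `Σ_k |x_k|^α`. -/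
def powSum (α : ℝ) (x : RField d) : ℝ≥0∞ := ∑' k, ENNReal.ofReal (|x k| ^ α)

lemma measurable_ofReal_abs_rpow (α : ℝ) (k : Fin d → ℤ) :
    Measurable fun x : RField d => ENNReal.ofReal (|x k| ^ α) :=
  ENNReal.measurable_ofReal.comp ((measurable_abs_apply k).pow_const α)

lemma measurable_powSum (α : ℝ) : Measurable (powSum α : RField d → ℝ≥0∞) :=
  Measurable.tsum fun k => measurable_ofReal_abs_rpow α k

lemma tsum_exIndGT (x : RField d) : ∑' k, exIndGT 1 k x = ((excSet x).encard : ℝ≥0∞) := by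
  rw [← ENNReal.tsum_set_one, tsum_subtype (excSet x) fun _ => (1 : ℝ≥0∞)]
  refine tsum_congr fun k => ?_
  by_cases h : 1 < |x k| <;> simp [exIndGT, Set.indicator, excSet, h]

lemma tsum_exIndGT_shift (k : Fin d → ℤ) (x : RField d) :
    ∑' i, exIndGT 1 i (shift k x) = ∑' i, exIndGT 1 i x :=
  (Equiv.addRight k).tsum_eq fun i => exIndGT 1 i x

lemma powSum_shift (α : ℝ) (k : Fin d → ℤ) (x : RField d) :
    powSum α (shift k x) = powSum α x :=
  (Equiv.addRight k).tsum_eq fun i => ENNReal.ofReal (|x i| ^ α)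

lemma supNorm_shift (k : Fin d → ℤ) (x : RField d) : supNorm (shift k x) = supNorm x :=
  (Equiv.addRight k).iSup_comp (g := fun i => |x i|)

lemma supNorm_smul {c : ℝ} (hc : 0 < c) (x : RField d) : supNorm (c • x) = c * supNorm x := by
  simp only [supNorm, Pi.smul_apply, smul_eq_mul, abs_mul, abs_of_pos hc]
  exact (Real.mul_iSup_of_nonneg hc.le _).symm

lemma powSum_smul (α : ℝ) {c : ℝ} (hc : 0 < c) (x : RField d) :
    powSum α (c • x) = ENNReal.ofReal (c ^ α) * powSum α x := by
  simp only [powSum, Pi.smul_apply, smul_eq_mul, abs_mul, abs_of_pos hc]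
  rw [← ENNReal.tsum_mul_left]
  refine tsum_congr fun k => ?_
  rw [Real.mul_rpow hc.le (abs_nonneg _), ENNReal.ofReal_mul (Real.rpow_nonneg hc.le _)]

/-- The ratio `‖x‖^α / Σ_k |x_k|^α`. -/
def normRatio (α : ℝ) (x : RField d) : ℝ≥0∞ := ENNReal.ofReal (supNorm x ^ α) / powSum α x

lemma measurable_normRatio (α : ℝ) : Measurable (normRatio α : RField d → ℝ≥0∞) :=
  (ENNReal.measurable_ofReal.comp (measurable_supNorm.pow_const α)).div (measurable_powSum α)

lemma normRatio_shift (α : ℝ) (k : Fin d → ℤ) (x : RField d) :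
    normRatio α (shift k x) = normRatio α x := by
  simp only [normRatio, powSum_shift, supNorm_shift]

lemma supNorm_nonneg (x : RField d) : 0 ≤ supNorm x := Real.iSup_nonneg fun _ => abs_nonneg _

lemma normRatio_smul (α : ℝ) {c : ℝ} (hc : 0 < c) (x : RField d) :
    normRatio α (c • x) = normRatio α x := by
  have hpos : 0 < c ^ α := Real.rpow_pos_of_pos hc α
  rw [normRatio, powSum_smul α hc, supNorm_smul hc, Real.mul_rpow hc.le (supNorm_nonneg x),
    ENNReal.ofReal_mul hpos.le]
  exact ENNReal.mul_div_mul_left _ _ (ENNReal.ofReal_pos.2 hpos).ne' ENNReal.ofReal_ne_top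

lemma abs_le_supNorm {x : RField d} (hx : x ∈ l0set d) (k : Fin d → ℤ) : |x k| ≤ supNorm x :=
  le_ciSup (Filter.Tendsto.bddAbove_range_of_cofinite hx) k

lemma finite_excSet {x : RField d} (hx : x ∈ l0set d) : (excSet x).Finite := by
  have h : ∀ᶠ i in cofinite, |x i| < 1 := Tendsto.eventually_lt_const one_pos hx
  refine (eventually_cofinite.1 h).subset fun i (hi : 1 < |x i|) => ?_
  exact not_lt.2 hi.le

lemma smul_mem_l0set (c : ℝ) {x : RField d} (hx : x ∈ l0set d) : c • x ∈ l0set d := by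
  have h : Tendsto (fun i => |c| * |x i|) cofinite (nhds (|c| * 0)) := Tendsto.const_mul _ hx
  simpa only [l0set, Set.mem_ofPred_eq, Pi.smul_apply, smul_eq_mul, abs_mul, mul_zero] using h

lemma shift_mem_l0set (k : Fin d → ℤ) {x : RField d} (hx : x ∈ l0set d) :
    shift k x ∈ l0set d :=
  Tendsto.comp hx (add_left_injective k).tendsto_cofinite

namespace FirstMaxData

variable (F : FirstMaxData d)

lemma Afm_eq_of_isLeast {x : RField d} (hx : x ∈ l0set d) (h0 : x ≠ 0) {a : Fin d → ℤ}
    (ha : |x a| = supNorm x) (hmin : ∀ k, |x k| = supNorm x → F.r a k) : F.Afm x = a := by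
  have := F.r_linear
  exact antisymm_of F.r (F.min_argmax x hx h0 a ha) (hmin _ (F.mem_argmax x hx h0))

lemma Afm_smul {c : ℝ} (hc : 0 < c) {x : RField d} (hx : x ∈ l0set d) (h0 : x ≠ 0) :
    F.Afm (c • x) = F.Afm x := by
  have habs : ∀ k, |(c • x) k| = c * |x k| := fun k => by
    rw [Pi.smul_apply, smul_eq_mul, abs_mul, abs_of_pos hc]
  refine F.Afm_eq_of_isLeast (smul_mem_l0set c hx) (smul_ne_zero hc.ne' h0) ?_ fun k hk => ?_
  · rw [habs, supNorm_smul hc, F.mem_argmax x hx h0]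
  · rw [habs, supNorm_smul hc] at hk
    exact F.min_argmax x hx h0 k (mul_left_cancel₀ hc.ne' hk)

lemma Afm_shift (k : Fin d → ℤ) {x : RField d} (hx : x ∈ l0set d) (h0 : x ≠ 0) :
    F.Afm (shift k x) = F.Afm x - k := by
  have h0' : shift k x ≠ 0 := fun h => h0 <| funext fun i => by
    simpa [shift] using congrFun h (i - k)
  refine F.Afm_eq_of_isLeast (shift_mem_l0set k hx) h0' ?_ fun i hi => ?_
  · rw [supNorm_shift, ← F.mem_argmax x hx h0, shift, sub_add_cancel]
  · rw [supNorm_shift] at hi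
    simpa [sub_eq_add_neg] using
      F.r_add_invariant _ _ (-k) (F.min_argmax x hx h0 (i + k) hi)

lemma measurableSet_Afm_eq (k : Fin d → ℤ) : MeasurableSet {x : RField d | F.Afm x = k} :=
  F.meas (measurableSet_singleton k)

/-- The `ℝ≥0∞`-valued indicator of the event that the first maximum is at the origin. -/
def anchorInd : RField d → ℝ≥0∞ := Set.indicator {x | F.Afm x = 0} 1

lemma measurable_anchorInd : Measurable F.anchorInd :=
  measurable_one.indicator (F.measurableSet_Afm_eq 0)

lemma lintegral_cond {Ω : Type*} [MeasurableSpace Ω] {μ : Measure Ω} {Θ : Ω → RField d}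
    (hΘ : Measurable Θ) {h : RField d → ℝ≥0∞} (hh : Measurable h) :
    ∫⁻ x, h x ∂(ProbabilityTheory.cond (Measure.map Θ μ) {x | F.Afm x = 0})
      = (∫⁻ ω, F.anchorInd (Θ ω) ∂μ)⁻¹ * ∫⁻ ω, F.anchorInd (Θ ω) * h (Θ ω) ∂μ := by
  rw [ProbabilityTheory.cond, lintegral_smul_measure, smul_eq_mul,
    ← lintegral_indicator_one (F.measurableSet_Afm_eq 0),
    ← lintegral_indicator (F.measurableSet_Afm_eq 0),
    lintegral_map (measurable_one.indicator (F.measurableSet_Afm_eq 0)) hΘ,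
    lintegral_map (hh.indicator (F.measurableSet_Afm_eq 0)) hΘ]
  congr 2
  funext ω
  by_cases hω : F.Afm (Θ ω) = 0 <;> simp [anchorInd, Set.indicator, hω]

end FirstMaxData

section TailProcess

variable {Ω : Type*} [MeasurableSpace Ω] {μ : Measure Ω} {Y : Ω → RField d}

/-- Mass transport from the origin to the first maximum. -/
lemma TailIdentity.lintegral_eq_anchored (F : FirstMaxData d) (hTI : TailIdentity μ Y)
    (hY : Measurable Y) (hl0 : ∀ᵐ ω ∂μ, Y ω ∈ l0set d) (hexc : ∀ᵐ ω ∂μ, 1 < |Y ω 0|)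
    {f : RField d → ℝ≥0∞} (hf : Measurable f) (hfs : ∀ k x, f (shift k x) = f x) :
    ∫⁻ ω, f (Y ω) ∂μ
      = ∫⁻ ω, F.anchorInd (Y ω) * f (Y ω) * ∑' k, exIndGT 1 k (Y ω) ∂μ := by
  have hm : Measurable fun x => F.anchorInd x * f x := F.measurable_anchorInd.mul hf
  have hpt : ∀ᵐ ω ∂μ, f (Y ω) = ∑' k, F.anchorInd (shift k (Y ω)) * f (shift k (Y ω))
      * exIndGT 1 k (Y ω) := by
    filter_upwards [hl0, hexc] with ω hω h1
    have h0 : Y ω ≠ 0 := fun h => by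
      rw [h] at h1
      norm_num at h1
    rw [tsum_eq_single (F.Afm (Y ω))]
    · have hmax : 1 < |Y ω (F.Afm (Y ω))| := by
        rw [F.mem_argmax _ hω h0]
        exact h1.trans_le (abs_le_supNorm hω 0)
      simp [FirstMaxData.anchorInd, F.Afm_shift _ hω h0, hfs, exIndGT, hmax]
    · intro k hk
      have : F.Afm (Y ω) - k ≠ 0 := sub_ne_zero.2 hk.symm
      simp [FirstMaxData.anchorInd, F.Afm_shift _ hω h0, this]
  have hm₁ : ∀ k, Measurable fun ω =>
      F.anchorInd (shift k (Y ω)) * f (shift k (Y ω)) * exIndGT 1 k (Y ω) := fun k =>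
    ((hm.comp (measurable_shift k)).comp hY).mul ((measurable_exIndGT 1 k).comp hY)
  have hm₂ : ∀ k, Measurable fun ω => F.anchorInd (Y ω) * f (Y ω) * exIndGT 1 k (Y ω) := fun k =>
    (hm.comp hY).mul ((measurable_exIndGT 1 k).comp hY)
  rw [lintegral_congr_ae hpt, lintegral_tsum fun k => (hm₁ k).aemeasurable, tsum_congr fun k => hTI _ hm k]
  refine ((Equiv.neg (Fin d → ℤ)).tsum_eq
    fun k => ∫⁻ ω, F.anchorInd (Y ω) * f (Y ω) * exIndGT 1 k (Y ω) ∂μ).trans ?_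
  rw [← lintegral_tsum fun k => (hm₂ k).aemeasurable]
  simp only [ENNReal.tsum_mul_left]

lemma IsPareto.measure_one_lt_mul {R : Ω → ℝ} {α : ℝ} (hα : 0 < α) (hR : IsPareto μ R α)
    {t : ℝ} (ht0 : 0 ≤ t) (ht1 : t ≤ 1) :
    μ {ω | 1 < R ω * t} = ENNReal.ofReal (t ^ α) := by
  rcases ht0.eq_or_lt with rfl | ht
  · simp [Real.zero_rpow hα.ne', not_lt.2 (zero_le_one' ℝ)]
  · have h := hR t⁻¹ ((one_le_inv₀ ht).2 ht1)
    rw [Real.inv_rpow ht0, Real.rpow_neg ht0, inv_inv] at h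
    rw [← h]
    congr 1
    ext ω
    simp only [Set.mem_ofPred_eq, inv_lt_iff_one_lt_mul₀ ht]

lemma lintegral_mul_tsum_exIndGT_smul [IsProbabilityMeasure μ] {R : Ω → ℝ} {Θ : Ω → RField d}
    {α : ℝ} (hα : 0 < α) (hR : Measurable R) (hR0 : ∀ᵐ ω ∂μ, 0 < R ω) (hΘ : Measurable Θ)
    (hPar : IsPareto μ R α) (hind : IndepFun R Θ μ) {g : RField d → ℝ≥0∞} (hg : Measurable g)
    (hbd : ∀ᵐ ω ∂μ, g (Θ ω) ≠ 0 → ∀ k, |Θ ω k| ≤ 1) :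
    ∫⁻ ω, g (Θ ω) * ∑' k, exIndGT 1 k (R ω • Θ ω) ∂μ
      = ∫⁻ ω, g (Θ ω) * powSum α (Θ ω) ∂μ := by
  have hset : ∀ k : Fin d → ℤ, MeasurableSet {p : ℝ × RField d | 1 < p.1 * |p.2 k|} := fun k =>
    measurableSet_lt measurable_const
      (measurable_fst.mul ((measurable_abs_apply k).comp measurable_snd))
  have hmeas : ∀ k : Fin d → ℤ, Measurable fun p : ℝ × RField d =>
      g p.2 * Set.indicator {p : ℝ × RField d | 1 < p.1 * |p.2 k|} 1 p := fun k =>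
    (hg.comp measurable_snd).mul (measurable_one.indicator (hset k))
  have hind' := (indepFun_iff_map_prod_eq_prod_map_map hR.aemeasurable hΘ.aemeasurable).1 hind
  have : IsProbabilityMeasure (μ.map R) := Measure.isProbabilityMeasure_map hR.aemeasurable
  have : IsProbabilityMeasure (μ.map Θ) := Measure.isProbabilityMeasure_map hΘ.aemeasurable
  have hterm : ∀ k : Fin d → ℤ,
      ∫⁻ ω, g (Θ ω) * Set.indicator {p : ℝ × RField d | 1 < p.1 * |p.2 k|} 1 (R ω, Θ ω) ∂μ
        = ∫⁻ ω, g (Θ ω) * ENNReal.ofReal (|Θ ω k| ^ α) ∂μ := by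
    intro k
    rw [← lintegral_map (hmeas k) (hR.prodMk hΘ), hind',
      lintegral_prod_symm _ (hmeas k).aemeasurable,
      lintegral_map (hmeas k).lintegral_prod_left' hΘ]
    refine lintegral_congr_ae ?_
    filter_upwards [hbd] with ω hω
    by_cases h0 : g (Θ ω) = 0
    · simp [h0]
    have hsec : MeasurableSet {r : ℝ | 1 < r * |Θ ω k|} :=
      measurableSet_lt measurable_const (measurable_id.mul_const _)
    have hinner : ∀ r : ℝ, Set.indicator {p : ℝ × RField d | 1 < p.1 * |p.2 k|}
        (1 : ℝ × RField d → ℝ≥0∞) (r, Θ ω) = Set.indicator {r : ℝ | 1 < r * |Θ ω k|} 1 r :=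
      fun r => by simp only [Set.indicator, Set.mem_ofPred_eq, Pi.one_apply]
    simp only [hinner]
    rw [lintegral_const_mul _ (measurable_one.indicator hsec), lintegral_indicator_one hsec,
      Measure.map_apply hR hsec]
    congr 1
    exact hPar.measure_one_lt_mul hα (abs_nonneg _) (hω h0 k)
  have hpt : ∀ᵐ ω ∂μ, g (Θ ω) * ∑' k, exIndGT 1 k (R ω • Θ ω) = ∑' k, g (Θ ω) *
      Set.indicator {p : ℝ × RField d | 1 < p.1 * |p.2 k|} 1 (R ω, Θ ω) := by
    filter_upwards [hR0] with ω hω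
    rw [← ENNReal.tsum_mul_left]
    refine tsum_congr fun k => ?_
    simp only [exIndGT, Pi.smul_apply, smul_eq_mul, abs_mul, abs_of_pos hω, Set.indicator,
      Set.mem_ofPred_eq, Pi.one_apply]
  have hm₁ : ∀ k : Fin d → ℤ, Measurable fun ω =>
      g (Θ ω) * Set.indicator {p : ℝ × RField d | 1 < p.1 * |p.2 k|} 1 (R ω, Θ ω) := fun k =>
    (hmeas k).comp (hR.prodMk hΘ)
  have hm₂ : ∀ k : Fin d → ℤ, Measurable fun ω =>
      g (Θ ω) * ENNReal.ofReal (|Θ ω k| ^ α) := fun k =>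
    (hg.mul (measurable_ofReal_abs_rpow α k)).comp hΘ
  rw [lintegral_congr_ae hpt, lintegral_tsum fun k => (hm₁ k).aemeasurable, tsum_congr hterm,
    ← lintegral_tsum fun k => (hm₂ k).aemeasurable]
  simp only [ENNReal.tsum_mul_left, powSum]

end TailProcess

/-- With `Y`, `Θ`, `ϑ`, `Q` as in the spectral Palm duality:
`E[Σ_k |Q_k|^α] = ϑ⁻¹ < ∞` and `E[‖Θ‖^α / Σ_k |Θ_k|^α] = ϑ > 0`. -/
theorem spectral_palm_normalizations
    {Ω : Type*} [MeasurableSpace Ω] (μ : Measure Ω) [IsProbabilityMeasure μ]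
    {Ω₂ : Type*} [MeasurableSpace Ω₂] (μ₂ : Measure Ω₂) [IsProbabilityMeasure μ₂]
    (Y : Ω → RField d) (hY : Measurable Y) (hTI : TailIdentity μ Y)
    (α : ℝ) (hα : 0 < α) (hPar : IsPareto μ (fun ω => |Y ω 0|) α)
    (Θ : Ω → RField d) (hΘdef : Θ = fun ω => fun i => Y ω i / |Y ω 0|)
    (hind : IndepFun (fun ω => |Y ω 0|) Θ μ)
    (hl0 : ∀ᵐ ω ∂μ, Θ ω ∈ l0set d)
    (ϑ : ℝ≥0∞) (hϑ : ϑ = ∫⁻ ω, ((excSet (Y ω)).encard)⁻¹ ∂μ)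
    (F : FirstMaxData d)
    (Q : Ω₂ → RField d) (hQ : Measurable Q) (hQl0 : ∀ᵐ ω ∂μ₂, Q ω ∈ l0set d)
    (hrep : IsSpectralRep μ Θ F μ₂ Q) :
    (∫⁻ ω, ∑' k : Fin d → ℤ, ENNReal.ofReal (|Q ω k| ^ α) ∂μ₂ = ϑ⁻¹) ∧ ϑ⁻¹ < ⊤ ∧
      (∫⁻ ω, ENNReal.ofReal (supNorm (Θ ω) ^ α) /
          (∑' k : Fin d → ℤ, ENNReal.ofReal (|Θ ω k| ^ α)) ∂μ = ϑ) ∧ 0 < ϑ := by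
  have hR : Measurable fun ω => |Y ω 0| := (measurable_abs_apply 0).comp hY
  have hpar1 : ∀ᵐ ω ∂μ, 1 < |Y ω 0| := by
    have h := hPar 1 le_rfl
    rw [Real.one_rpow, ENNReal.ofReal_one] at h
    exact (prob_compl_eq_zero_iff (measurableSet_lt measurable_const hR)).2 h
  have hΘ : Measurable Θ := by
    rw [hΘdef]
    exact measurable_pi_lambda _ fun i => ((measurable_pi_apply i).comp hY).div hR
  have hR0 : ∀ᵐ ω ∂μ, 0 < |Y ω 0| := hpar1.mono fun ω hω => one_pos.trans hω
  have hYΘ : ∀ᵐ ω ∂μ, Y ω = |Y ω 0| • Θ ω := by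
    filter_upwards [hR0] with ω hω
    funext i
    simp only [hΘdef, Pi.smul_apply, smul_eq_mul]
    exact (mul_div_cancel₀ _ hω.ne').symm
  have hΘ0 : ∀ᵐ ω ∂μ, |Θ ω 0| = 1 := by
    filter_upwards [hR0] with ω hω
    simp only [hΘdef, abs_div, abs_abs]
    exact div_self hω.ne'
  have hΘne : ∀ᵐ ω ∂μ, Θ ω ≠ 0 := hΘ0.mono fun ω hω h => by
    rw [h] at hω
    norm_num at hω
  have hYl0 : ∀ᵐ ω ∂μ, Y ω ∈ l0set d := by
    filter_upwards [hYΘ, hl0] with ω h1 h2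
    rw [h1]
    exact smul_mem_l0set _ h2
  have hanchor : ∀ᵐ ω ∂μ, F.anchorInd (Y ω) = F.anchorInd (Θ ω) := by
    filter_upwards [hYΘ, hl0, hR0, hΘne] with ω h1 h2 h3 h4
    have : F.Afm (Y ω) = F.Afm (Θ ω) := by
      conv_lhs => rw [h1]
      exact F.Afm_smul h3 h2 h4
    simp only [FirstMaxData.anchorInd, Set.indicator, Set.mem_ofPred_eq, this, Pi.one_apply]
  have hsup : ∀ᵐ ω ∂μ, F.anchorInd (Θ ω) ≠ 0 → supNorm (Θ ω) = 1 := by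
    filter_upwards [hl0, hΘ0, hΘne] with ω h1 h2 h3 h4
    have h5 : F.Afm (Θ ω) = 0 := by
      by_contra h
      exact h4 (Set.indicator_of_notMem (s := {x | F.Afm x = 0}) h 1)
    rw [← F.mem_argmax _ h1 h3, h5, h2]
  have key : ∀ f : RField d → ℝ≥0∞, Measurable f → (∀ k x, f (shift k x) = f x) →
      (∀ c : ℝ, 0 < c → ∀ x, f (c • x) = f x) →
      ∫⁻ ω, f (Θ ω) ∂μ = ∫⁻ ω, F.anchorInd (Θ ω) * f (Θ ω) * powSum α (Θ ω) ∂μ := by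
    intro f hf hfs hfc
    have hfY : ∀ᵐ ω ∂μ, f (Y ω) = f (Θ ω) := by
      filter_upwards [hYΘ, hR0] with ω h1 h2
      conv_lhs => rw [h1]
      exact hfc _ h2 _
    rw [← lintegral_congr_ae hfY, hTI.lintegral_eq_anchored F hY hYl0 hpar1 hf hfs]
    refine Eq.trans (lintegral_congr_ae ?_) (lintegral_mul_tsum_exIndGT_smul hα hR hR0 hΘ hPar
      hind (F.measurable_anchorInd.mul hf) ?_)
    · filter_upwards [hanchor, hfY, hYΘ] with ω h1 h2 h3
      rw [Pi.mul_apply, h1, h2, ← h3]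
    · filter_upwards [hsup, hl0] with ω h1 h2 h3 k
      rw [← h1 (left_ne_zero_of_mul h3)]
      exact abs_le_supNorm h2 k
  have hpow : ∫⁻ ω, F.anchorInd (Θ ω) * powSum α (Θ ω) ∂μ = 1 := by
    have h := key 1 measurable_one (fun _ _ => rfl) (fun _ _ _ => rfl)
    simpa using h.symm
  have hprob : ∫⁻ ω, F.anchorInd (Θ ω) ∂μ = ϑ := by
    have hm : Measurable fun x : RField d => (∑' k, exIndGT 1 k x)⁻¹ :=
      (Measurable.tsum fun k => measurable_exIndGT 1 k).inv
    have h := hTI.lintegral_eq_anchored F hY hYl0 hpar1 hm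
      fun k x => by rw [tsum_exIndGT_shift]
    simp only [tsum_exIndGT] at h
    rw [hϑ, h]
    refine lintegral_congr_ae ?_
    filter_upwards [hanchor, hYl0, hpar1] with ω h1 h2 h3
    have hne : ((excSet (Y ω)).encard : ℝ≥0∞) ≠ 0 := by
      have : (excSet (Y ω)).Nonempty := ⟨0, h3⟩
      simpa using this.ne_empty
    have hfin : ((excSet (Y ω)).encard : ℝ≥0∞) ≠ ⊤ := by
      simpa using finite_excSet h2
    rw [h1, mul_assoc, ENNReal.inv_mul_cancel hne hfin, mul_one]
  have hϑpos : 0 < ϑ := by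
    rw [pos_iff_ne_zero, ← hprob]
    intro h
    have h' := (lintegral_eq_zero_iff (F.measurable_anchorInd.comp hΘ)).1 h
    have h0 : ∫⁻ ω, F.anchorInd (Θ ω) * powSum α (Θ ω) ∂μ = 0 := by
      refine (lintegral_eq_zero_iff
        ((F.measurable_anchorInd.mul (measurable_powSum α)).comp hΘ)).2 ?_
      filter_upwards [h'] with ω hω
      have hω' : F.anchorInd (Θ ω) = 0 := hω
      simp [hω']
    exact zero_ne_one (h0.symm.trans hpow)
  refine ⟨?_, ENNReal.inv_lt_top.2 hϑpos, ?_, hϑpos⟩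
  · have h := hrep (powSum α) (measurable_powSum α) fun x _ k => powSum_shift α k x
    rw [F.lintegral_cond hΘ (measurable_powSum α), hpow, hprob, mul_one] at h
    exact h
  · have h := key (normRatio α) (measurable_normRatio α) (normRatio_shift α)
      fun c hc x => normRatio_smul α hc x
    refine h.trans (Eq.trans (lintegral_congr_ae ?_) hprob)
    have hfin := ae_lt_top ((F.measurable_anchorInd.mul (measurable_powSum α)).comp hΘ)
      (hpow.trans_ne one_ne_top)
    filter_upwards [hfin, hsup, hΘ0] with ω h1 h2 h3
    by_cases hA : F.anchorInd (Θ ω) = 0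
    · simp [hA]
    have hne : powSum α (Θ ω) ≠ 0 := fun h0 => by
      have h4 := ENNReal.tsum_eq_zero.1 h0 0
      rw [h3, Real.one_rpow, ENNReal.ofReal_one] at h4
      exact one_ne_zero h4
    have htop : powSum α (Θ ω) ≠ ⊤ := fun h0 => by
      refine h1.ne ?_
      simp only [Function.comp_apply, Pi.mul_apply, h0]
      exact ENNReal.mul_top hA
    rw [mul_assoc, normRatio, ENNReal.div_mul_cancel hne htop, h2 hA, Real.one_rpow,
      ENNReal.ofReal_one, mul_one]
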